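/- arXiv:1304.6263 — 3 statements merged into one kernel-verified Lean document; each statement's English description precedes it below -/
import Mathlib

section
/- Let r ≥ 13 be an integer and let G be a finite simple graph with maximum degree Δ(G) ≤ r. Suppose uv is an edge of G with d_G(u) ≤ ⌊r/2⌋ and d_G(u) + d_G(v) ≤ r + 2. If the graph G − uv obtained by deleting the edge uv admits a total (r+2)-coloring, then G itself admits a total (r+2)-coloring. -/
/-- A total `k`-coloring of a simple graph `G`: colors from `Fin k` are assigned to all
vertices and to all edges so that adjacent vertices get distinct colors, distinct edges
sharing an endpoint get distinct colors, and each edge gets a color distinct from the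
colors of both of its endpoints. -/
def HasTotalColoring {V : Type*} (G : SimpleGraph V) (k : ℕ) : Prop :=
  ∃ (cV : V → Fin k) (cE : Sym2 V → Fin k),
    (∀ u v : V, G.Adj u v → cV u ≠ cV v) ∧
    (∀ e₁ ∈ G.edgeSet, ∀ e₂ ∈ G.edgeSet, e₁ ≠ e₂ → (∃ x, x ∈ e₁ ∧ x ∈ e₂) →
      cE e₁ ≠ cE e₂) ∧
    (∀ e ∈ G.edgeSet, ∀ x ∈ e, cE e ≠ cV x)

/-- For `r ≥ 13`, a graph is `r`-minimal if it is a finite connected simple graph with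
maximum degree at most `r` admitting no total `(r+2)`-coloring, such that deleting any
edge yields a graph admitting a total `(r+2)`-coloring. -/
def IsRMinimal {V : Type*} [Fintype V] (r : ℕ) (G : SimpleGraph V)
    [DecidableRel G.Adj] : Prop :=
  G.Connected ∧ G.maxDegree ≤ r ∧ ¬ HasTotalColoring G (r + 2) ∧
    ∀ e ∈ G.edgeSet, HasTotalColoring (G.deleteEdges {e}) (r + 2)

/-- A set of fewer than `k` colors misses some color in `Fin k`. -/
lemma exists_color_notMem {k : ℕ} (s : Finset (Fin k)) (hs : s.card < k) : ∃ c, c ∉ s := by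
  by_contra! h
  have := Finset.card_le_card (fun c _ => h c : Finset.univ ⊆ s)
  simp at this
  omega

/-- If Δ(G) ≤ r (r ≥ 13), uv is an edge with d_G(u) ≤ ⌊r/2⌋ and
d_G(u) + d_G(v) ≤ r + 2, and G − uv admits a total (r+2)-coloring, then so does G. -/
theorem stmt_1 {V : Type*} [Fintype V] (r : ℕ) (hr : 13 ≤ r)
    (G : SimpleGraph V) [DecidableRel G.Adj] (hΔ : G.maxDegree ≤ r)
    (u v : V) (huv : G.Adj u v) (hdu : G.degree u ≤ r / 2)
    (hsum : G.degree u + G.degree v ≤ r + 2)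
    (hcol : HasTotalColoring (G.deleteEdges {s(u, v)}) (r + 2)) :
    HasTotalColoring G (r + 2) := by
  classical
  obtain ⟨cV, cE, hV, hE, hI⟩ := hcol
  obtain ⟨c, hc⟩ : ∃ c, c ∉ ((G.neighborFinset u).erase v).image (fun x => cE s(u, x)) ∪
      ((G.neighborFinset v).erase u).image (fun x => cE s(v, x)) ∪ {cV v} := by
    apply exists_color_notMem
    have h₁ := Finset.card_image_le (s := (G.neighborFinset u).erase v) (f := fun x => cE s(u, x))
    have h₂ := Finset.card_image_le (s := (G.neighborFinset v).erase u) (f := fun x => cE s(v, x))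
    rw [Finset.card_erase_of_mem (by simpa using huv), G.card_neighborFinset_eq_degree] at h₁
    rw [Finset.card_erase_of_mem (by simpa using huv.symm), G.card_neighborFinset_eq_degree] at h₂
    have hu : 0 < G.degree u := (G.degree_pos_iff_exists_adj u).2 ⟨v, huv⟩
    have hv : 0 < G.degree v := (G.degree_pos_iff_exists_adj v).2 ⟨u, huv.symm⟩
    refine (Finset.card_union_le _ _).trans_lt ?_
    refine (Nat.add_le_add_right (Finset.card_union_le _ _) _).trans_lt ?_
    rw [Finset.card_singleton]
    omega
  simp only [Finset.mem_union, Finset.mem_image, Finset.mem_erase, SimpleGraph.mem_neighborFinset,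
    Finset.mem_singleton, not_or, not_exists, not_and] at hc
  obtain ⟨⟨hcu, hcv⟩, hcV⟩ := hc
  set cE' := Function.update cE s(u, v) c with hcE'
  obtain ⟨a, ha⟩ : ∃ a, a ∉ (G.neighborFinset u).image cV ∪
      (G.neighborFinset u).image (fun x => cE' s(u, x)) := by
    apply exists_color_notMem
    have h₁ := Finset.card_image_le (s := G.neighborFinset u) (f := cV)
    have h₂ := Finset.card_image_le (s := G.neighborFinset u) (f := fun x => cE' s(u, x))
    rw [G.card_neighborFinset_eq_degree] at h₁ h₂
    refine (Finset.card_union_le _ _).trans_lt ?_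
    omega
  simp only [Finset.mem_union, Finset.mem_image, SimpleGraph.mem_neighborFinset, not_or,
    not_exists, not_and] at ha
  obtain ⟨haV, haE⟩ := ha
  have hnew : cE' s(u, v) = c := Function.update_self ..
  have hold : ∀ e, e ≠ s(u, v) → cE' e = cE e := fun e he => Function.update_of_ne he ..
  have hdel : ∀ e ∈ G.edgeSet, e ≠ s(u, v) → e ∈ (G.deleteEdges {s(u, v)}).edgeSet :=
    fun e he hne => by simpa [SimpleGraph.edgeSet_deleteEdges] using ⟨he, hne⟩
  have hadj : ∀ e ∈ G.edgeSet, e ≠ s(u, v) → (∃ x, x ∈ s(u, v) ∧ x ∈ e) → cE e ≠ c := by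
    rintro e he hne ⟨x, hx, hxe⟩
    obtain ⟨y, rfl⟩ := Sym2.mem_iff_exists.1 hxe
    rw [SimpleGraph.mem_edgeSet] at he
    rcases Sym2.mem_iff.1 hx with rfl | rfl
    · exact hcu y ⟨fun h => hne (by rw [h]), he⟩
    · exact hcv y ⟨fun h => hne (by rw [h, Sym2.eq_swap]), he⟩
  refine ⟨Function.update cV u a, cE', ?_, ?_, ?_⟩
  · intro x y hxy
    by_cases hx : x = u
    · subst hx
      rw [Function.update_self, Function.update_of_ne hxy.ne']
      exact Ne.symm (haV y hxy)
    · rw [Function.update_of_ne hx]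
      by_cases hy : y = u
      · subst hy
        rw [Function.update_self]
        exact haV x hxy.symm
      · rw [Function.update_of_ne hy]
        refine hV x y ?_
        rw [SimpleGraph.deleteEdges_adj]
        refine ⟨hxy, fun h => ?_⟩
        rw [Set.mem_singleton_iff, Sym2.eq_iff] at h
        tauto
  · rintro e₁ h₁ e₂ h₂ hne ⟨x, hx₁, hx₂⟩
    by_cases he₁ : e₁ = s(u, v)
    · subst he₁
      rw [hnew, hold e₂ hne.symm]
      exact (hadj e₂ h₂ hne.symm ⟨x, hx₁, hx₂⟩).symm
    · rw [hold e₁ he₁]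
      by_cases he₂ : e₂ = s(u, v)
      · subst he₂
        rw [hnew]
        exact hadj e₁ h₁ hne ⟨x, hx₂, hx₁⟩
      · rw [hold e₂ he₂]
        exact hE e₁ (hdel e₁ h₁ he₁) e₂ (hdel e₂ h₂ he₂) hne ⟨x, hx₁, hx₂⟩
  · intro e he x hx
    by_cases hxu : x = u
    · subst hxu
      rw [Function.update_self]
      obtain ⟨y, rfl⟩ := Sym2.mem_iff_exists.1 hx
      exact haE y he
    · rw [Function.update_of_ne hxu]
      by_cases h : e = s(u, v)
      · subst h
        rw [hnew]
        obtain rfl : x = v := (Sym2.mem_iff.1 hx).resolve_left hxu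
        exact hcV
      · rw [hold e h]
        exact hI e (hdel e he h) x hx
end

section
/- Let r ≥ 13 be an integer and let G be an r-minimal graph. Then the minimum degree of G is at least 3; that is, every vertex of G has degree at least 3. -/
/-- A total coloring of `G - uv` extends to `G` if the degrees of `u` and `v` are small enough
compared to the number of colors: color the edge `uv` greedily, then recolor `v` greedily. -/
theorem HasTotalColoring.of_deleteEdges {V : Type*} [Fintype V] {G : SimpleGraph V}
    [DecidableRel G.Adj] {k : ℕ} {u v : V} (huv : G.Adj u v)
    (hdeg : G.degree u + G.degree v ≤ k) (hv : 2 * G.degree v < k)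
    (h : HasTotalColoring (G.deleteEdges {s(u, v)}) k) : HasTotalColoring G k := by
  classical
  obtain ⟨cV, cE, hV, hE, hVE⟩ := h
  obtain ⟨a, ha⟩ : ∃ a, a ∉ insert (cV u)
      (((G.neighborFinset u).erase v).image (fun x ↦ cE s(u, x)) ∪
        ((G.neighborFinset v).erase u).image (fun x ↦ cE s(v, x))) := by
    by_contra! hall
    have hcard := Finset.card_le_card (fun c (_ : c ∈ Finset.univ) ↦ hall c)
    rw [Finset.card_univ, Fintype.card_fin] at hcard
    have h₁ := Finset.card_insert_le (cV u)
      (((G.neighborFinset u).erase v).image (fun x ↦ cE s(u, x)) ∪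
        ((G.neighborFinset v).erase u).image (fun x ↦ cE s(v, x)))
    have h₂ := Finset.card_union_le
      (((G.neighborFinset u).erase v).image (fun x ↦ cE s(u, x)))
      (((G.neighborFinset v).erase u).image (fun x ↦ cE s(v, x)))
    have h₃ := Finset.card_image_le (s := (G.neighborFinset u).erase v)
      (f := fun x ↦ cE s(u, x))
    have h₄ := Finset.card_image_le (s := (G.neighborFinset v).erase u)
      (f := fun x ↦ cE s(v, x))
    rw [Finset.card_erase_of_mem (by simpa using huv), G.card_neighborFinset_eq_degree] at h₃
    rw [Finset.card_erase_of_mem (by simpa using huv.symm),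
      G.card_neighborFinset_eq_degree] at h₄
    have := (G.degree_pos_iff_exists_adj u).2 ⟨v, huv⟩
    have := (G.degree_pos_iff_exists_adj v).2 ⟨u, huv.symm⟩
    omega
  simp only [Finset.mem_insert, Finset.mem_union, Finset.mem_image, Finset.mem_erase,
    SimpleGraph.mem_neighborFinset, not_or, not_exists, not_and, and_imp] at ha
  obtain ⟨hau, hane_u, hane_v⟩ := ha
  set cE' := Function.update cE s(u, v) a with hcE'
  obtain ⟨b, hb⟩ : ∃ b, b ∉ (G.neighborFinset v).image cV ∪
      (G.neighborFinset v).image (fun x ↦ cE' s(v, x)) := by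
    by_contra! hall
    have hcard := Finset.card_le_card (fun c (_ : c ∈ Finset.univ) ↦ hall c)
    rw [Finset.card_univ, Fintype.card_fin] at hcard
    have h₂ := Finset.card_union_le ((G.neighborFinset v).image cV)
      ((G.neighborFinset v).image (fun x ↦ cE' s(v, x)))
    have h₃ := Finset.card_image_le (s := G.neighborFinset v) (f := cV)
    have h₄ := Finset.card_image_le (s := G.neighborFinset v) (f := fun x ↦ cE' s(v, x))
    rw [G.card_neighborFinset_eq_degree] at h₃ h₄
    omega
  simp only [Finset.mem_union, Finset.mem_image, SimpleGraph.mem_neighborFinset, not_or,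
    not_exists, not_and] at hb
  obtain ⟨hbV, hbE⟩ := hb
  have hdel : ∀ e ∈ G.edgeSet, e ≠ s(u, v) → e ∈ (G.deleteEdges {s(u, v)}).edgeSet := by
    intro e he hne
    simp [SimpleGraph.edgeSet_deleteEdges, he, hne]
  have ha_ne : ∀ e ∈ G.edgeSet, e ≠ s(u, v) → (∃ x, x ∈ s(u, v) ∧ x ∈ e) → cE e ≠ a := by
    rintro e he hne ⟨x, hx, hxe⟩
    obtain ⟨y, rfl⟩ := Sym2.mem_iff_exists.1 hxe
    rcases Sym2.mem_iff.1 hx with rfl | rfl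
    · exact hane_u y (by rintro rfl; exact hne rfl) he
    · exact hane_v y (by rintro rfl; exact hne Sym2.eq_swap) he
  refine ⟨Function.update cV v b, cE', ?_, ?_, ?_⟩
  · intro x y hxy
    rcases eq_or_ne x v with rfl | hx
    · rw [Function.update_self, Function.update_of_ne hxy.ne']
      exact Ne.symm (hbV y hxy)
    rcases eq_or_ne y v with rfl | hy
    · rw [Function.update_self, Function.update_of_ne hx]
      exact hbV x hxy.symm
    rw [Function.update_of_ne hx, Function.update_of_ne hy]
    refine hV x y (hdel s(x, y) hxy fun heq ↦ ?_)
    have hmem : v ∈ s(x, y) := heq ▸ Sym2.mem_mk_right u v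
    rcases Sym2.mem_iff.1 hmem with rfl | rfl
    exacts [hx rfl, hy rfl]
  · rintro e₁ he₁ e₂ he₂ hne ⟨x, hx₁, hx₂⟩
    rcases eq_or_ne e₁ s(u, v) with rfl | h₁
    · rw [hcE', Function.update_self, Function.update_of_ne hne.symm]
      exact (ha_ne e₂ he₂ hne.symm ⟨x, hx₁, hx₂⟩).symm
    rcases eq_or_ne e₂ s(u, v) with rfl | h₂
    · rw [hcE', Function.update_self, Function.update_of_ne hne]
      exact ha_ne e₁ he₁ hne ⟨x, hx₂, hx₁⟩
    rw [hcE', Function.update_of_ne h₁, Function.update_of_ne h₂]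
    exact hE e₁ (hdel e₁ he₁ h₁) e₂ (hdel e₂ he₂ h₂) hne ⟨x, hx₁, hx₂⟩
  · intro e he x hxe
    rcases eq_or_ne x v with rfl | hx
    · obtain ⟨y, rfl⟩ := Sym2.mem_iff_exists.1 hxe
      rw [Function.update_self]
      exact hbE y he
    rw [Function.update_of_ne hx]
    rcases eq_or_ne e s(u, v) with rfl | hne
    · obtain rfl : x = u := (Sym2.mem_iff.1 hxe).resolve_right hx
      rw [hcE', Function.update_self]
      exact hau
    · rw [hcE', Function.update_of_ne hne]
      exact hVE e (hdel e he hne) x hxe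

/-- A graph on at most one vertex has a total coloring as soon as there is a color. -/
theorem HasTotalColoring.of_subsingleton {V : Type*} [Subsingleton V] (G : SimpleGraph V)
    (k : ℕ) [NeZero k] : HasTotalColoring G k := by
  obtain rfl : G = ⊥ := Subsingleton.elim _ _
  exact ⟨fun _ ↦ 0, fun _ ↦ 0, by simp, by simp, by simp⟩

/-- Every r-minimal graph (r ≥ 13) has minimum degree at least 3. -/
theorem stmt_5 {V : Type*} [Fintype V] (r : ℕ) (hr : 13 ≤ r)
    (G : SimpleGraph V) [DecidableRel G.Adj] (hG : IsRMinimal r G) :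
    ∀ v : V, 3 ≤ G.degree v := by
  intro v
  by_contra! hlt
  obtain ⟨hconn, hmax, hnot, hdel⟩ := hG
  rcases subsingleton_or_nontrivial V with _ | _
  · exact hnot (.of_subsingleton G (r + 2))
  obtain ⟨u, hvu⟩ := (G.degree_pos_iff_exists_adj v).1
    (hconn.preconnected.degree_pos_of_nontrivial v)
  have hu := (G.degree_le_maxDegree u).trans hmax
  exact hnot (.of_deleteEdges hvu.symm (by omega) (by omega) (hdel s(u, v) hvu.symm))
end

section
/- Let r ≥ 13 be an integer and let G be an r-minimal graph. Then the spanning subgraph H of G whose edge set consists of all edges of G having at least one endpoint of degree 3 in G is a forest; that is, H contains no cycle. -/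
open Finset in
/-- A coloring that is proper away from an independent set `U` of vertices of small degree
can be repaired on `U`. -/
theorem HasTotalColoring.of_forall_notMem {V : Type*} [Fintype V] {G : SimpleGraph V}
    [DecidableRel G.Adj] {k : ℕ} {U : Set V} (hU : ∀ u ∈ U, ∀ v ∈ U, ¬ G.Adj u v)
    (hdeg : ∀ u ∈ U, 2 * G.degree u < k) {cV : V → Fin k} {cE : Sym2 V → Fin k}
    (hV : ∀ u v, G.Adj u v → u ∉ U → v ∉ U → cV u ≠ cV v)
    (hE : ∀ e₁ ∈ G.edgeSet, ∀ e₂ ∈ G.edgeSet, e₁ ≠ e₂ → (∃ x, x ∈ e₁ ∧ x ∈ e₂) →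
      cE e₁ ≠ cE e₂)
    (hVE : ∀ e ∈ G.edgeSet, ∀ x ∈ e, x ∉ U → cE e ≠ cV x) :
    HasTotalColoring G k := by
  classical
  have key : ∀ u, ∃ a : Fin k, u ∈ U →
      (∀ v, G.Adj u v → a ≠ cV v) ∧ ∀ e ∈ G.edgeSet, u ∈ e → a ≠ cE e := by
    intro u
    by_cases hu : u ∈ U
    · have hcard : #((G.neighborFinset u).image cV ∪ (G.incidenceFinset u).image cE)
          < #(univ : Finset (Fin k)) := by
        have h₁ := card_union_le ((G.neighborFinset u).image cV)
          ((G.incidenceFinset u).image cE)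
        have h₂ : #((G.neighborFinset u).image cV) ≤ _ := card_image_le
        have h₃ : #((G.incidenceFinset u).image cE) ≤ _ := card_image_le
        rw [G.card_neighborFinset_eq_degree] at h₂
        rw [G.card_incidenceFinset_eq_degree] at h₃
        have := hdeg u hu
        rw [card_univ, Fintype.card_fin]
        omega
      obtain ⟨a, -, ha⟩ := exists_mem_notMem_of_card_lt_card hcard
      refine ⟨a, fun _ => ⟨fun v hv h => ha ?_, fun e he hue h => ha ?_⟩⟩
      · exact mem_union_left _ (mem_image.2 ⟨v, by simpa using hv, h.symm⟩)
      · exact mem_union_right _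
          (mem_image.2 ⟨e, by simpa using ⟨he, hue⟩, h.symm⟩)
    · exact ⟨cV u, fun h => absurd h hu⟩
  choose a ha using key
  refine ⟨U.piecewise a cV, cE, fun u v huv => ?_, hE, fun e he x hx => ?_⟩
  · by_cases hu : u ∈ U <;> by_cases hv : v ∈ U
    · exact absurd huv (hU u hu v hv)
    · simpa [hu, hv] using (ha u hu).1 v huv
    · simpa [hu, hv] using ((ha v hv).1 u huv.symm).symm
    · simpa [hu, hv] using hV u v huv hu hv
  · by_cases hu : x ∈ U
    · simpa [hu] using ((ha x hu).2 e he hx).symm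
    · simpa [hu] using hVE e he x hx hu

open Finset Classical in
/-- The colors which an edge `e` to be recolored may not receive, when the colors of the edges
in `S` and of the vertices in `U` have been erased. -/
noncomputable def forbiddenColors {V : Type*} [Fintype V] (G : SimpleGraph V)
    [DecidableRel G.Adj] {k : ℕ} (S : Set (Sym2 V)) (U : Set V) (cV : V → Fin k) (cE : Sym2 V → Fin k) (e : Sym2 V) :
    Finset (Fin k) :=
  image cE {e' | e' ∈ G.edgeSet ∧ e' ∉ S ∧ ∃ x, x ∈ e ∧ x ∈ e'} ∪
    image cV {x | x ∈ e ∧ x ∉ U}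

open Finset in
theorem card_forbiddenColors_le {V : Type*} [Fintype V] {G : SimpleGraph V}
    [DecidableRel G.Adj] {k : ℕ} {S : Set (Sym2 V)} {U : Set V} (cV : V → Fin k)
    (cE : Sym2 V → Fin k) {u v : V} (hu : u ∈ U) {A B : Finset (Sym2 V)}
    (hA : ∀ e ∈ G.edgeSet, u ∈ e → e ∉ S → e ∈ A)
    (hB : ∀ e ∈ G.edgeSet, v ∈ e → e ∉ S → e ∈ B) :
    #(forbiddenColors G S U cV cE s(u, v)) ≤ #A + #B + 1 := by
  classical
  refine (card_union_le _ _).trans (add_le_add ?_ ?_)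
  · refine card_image_le.trans ((card_le_card fun e he => ?_).trans (card_union_le _ _))
    obtain ⟨heG, heS, x, hx, hxe⟩ := (mem_filter.1 he).2
    rcases Sym2.mem_iff.1 hx with rfl | rfl
    · exact mem_union_left _ (hA e heG hxe heS)
    · exact mem_union_right _ (hB e heG hxe heS)
  · refine card_image_le.trans ((card_le_card fun x hx => ?_).trans (card_singleton v).le)
    obtain ⟨hx, hxU⟩ := (mem_filter.1 hx).2
    rcases Sym2.mem_iff.1 hx with rfl | rfl
    · exact absurd hu hxU
    · exact mem_singleton_self _

/-- Recoloring of the edges in `S` and of the vertices in `U`, where `S` contains the deleted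
edge `e₀`. -/
theorem HasTotalColoring.of_recoloring {V : Type*} [Fintype V] {G : SimpleGraph V}
    [DecidableRel G.Adj] {k : ℕ} {U : Set V} (hU : ∀ u ∈ U, ∀ v ∈ U, ¬ G.Adj u v)
    (hdeg : ∀ u ∈ U, 2 * G.degree u < k) {S : Set (Sym2 V)} {e₀ : Sym2 V} (he₀ : e₀ ∈ S)
    (hS : ∃ u v, e₀ = s(u, v) ∧ u ∈ U)
    {cV : V → Fin k} {cE : Sym2 V → Fin k}
    (hV : ∀ u v, (G.deleteEdges {e₀}).Adj u v → cV u ≠ cV v)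
    (hE : ∀ e₁ ∈ (G.deleteEdges {e₀}).edgeSet, ∀ e₂ ∈ (G.deleteEdges {e₀}).edgeSet, e₁ ≠ e₂ →
      (∃ x, x ∈ e₁ ∧ x ∈ e₂) → cE e₁ ≠ cE e₂)
    (hVE : ∀ e ∈ (G.deleteEdges {e₀}).edgeSet, ∀ x ∈ e, cE e ≠ cV x)
    {f : Sym2 V → Fin k} (hf : ∀ e ∈ S, f e ∉ forbiddenColors G S U cV cE e)
    (hfS : ∀ e₁ ∈ S, ∀ e₂ ∈ S, e₁ ≠ e₂ → (∃ x, x ∈ e₁ ∧ x ∈ e₂) → f e₁ ≠ f e₂) :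
    HasTotalColoring G k := by
  classical
  have hf₁ : ∀ e₁ ∈ S, ∀ e₂ ∈ G.edgeSet, e₂ ∉ S → (∃ x, x ∈ e₁ ∧ x ∈ e₂) → f e₁ ≠ cE e₂ := by
    intro e₁ h₁ e₂ h₂ h₂S hx h
    exact hf e₁ h₁ (Finset.mem_union_left _ (Finset.mem_image.2 ⟨e₂, by simp [*], h.symm⟩))
  have hf₂ : ∀ e ∈ S, ∀ x ∈ e, x ∉ U → f e ≠ cV x := by
    intro e he x hx hxU h
    exact hf e he (Finset.mem_union_right _ (Finset.mem_image.2 ⟨x, by simp [*], h.symm⟩))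
  have hdel : ∀ e ∈ G.edgeSet, e ∉ S → e ∈ (G.deleteEdges {e₀}).edgeSet := by
    intro e he heS
    rw [SimpleGraph.edgeSet_deleteEdges]
    exact ⟨he, fun h => heS (h ▸ he₀)⟩
  refine HasTotalColoring.of_forall_notMem (cV := cV) (cE := S.piecewise f cE) hU hdeg
    (fun u v huv hu hv => hV u v ?_) (fun e₁ h₁ e₂ h₂ hne hx => ?_) (fun e he x hx hxU => ?_)
  · obtain ⟨a, b, rfl, ha⟩ := hS
    refine SimpleGraph.deleteEdges_adj.2 ⟨huv, fun h => ?_⟩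
    rcases Sym2.mem_iff.1 (h ▸ Sym2.mem_mk_left a b : a ∈ s(u, v)) with rfl | rfl
    · exact hu ha
    · exact hv ha
  · by_cases h₁S : e₁ ∈ S <;> by_cases h₂S : e₂ ∈ S
    · simpa [h₁S, h₂S] using hfS e₁ h₁S e₂ h₂S hne hx
    · simpa [h₁S, h₂S] using hf₁ e₁ h₁S e₂ h₂ h₂S hx
    · simpa [h₁S, h₂S] using (hf₁ e₂ h₂S e₁ h₁ h₁S (hx.imp fun _ => And.symm)).symm
    · simpa [h₁S, h₂S] using hE e₁ (hdel _ h₁ h₁S) e₂ (hdel _ h₂ h₂S) hne hx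
  · by_cases heS : e ∈ S
    · simpa [heS] using hf₂ e heS x hx hxU
    · simpa [heS] using hVE e (hdel e he heS) x hx

open Finset in
/-- A neighbor of a vertex of degree 3 in an `r`-minimal graph has degree `r`. -/
theorem IsRMinimal.degree_eq_of_adj {V : Type*} [Fintype V] {r : ℕ} (hr : 5 ≤ r)
    {G : SimpleGraph V} [DecidableRel G.Adj] (hG : IsRMinimal r G) {u v : V}
    (huv : G.Adj u v) (hu : G.degree u = 3) : G.degree v = r := by
  classical
  obtain ⟨-, hmax, hno, hmin⟩ := hG
  by_contra hne
  have hlt : G.degree v < r := lt_of_le_of_ne ((G.degree_le_maxDegree v).trans hmax) hne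
  obtain ⟨cV, cE, hV, hE, hVE⟩ := hmin s(u, v) huv
  have hcard : ∀ w ∈ s(u, v),
      #((G.incidenceFinset w).erase s(u, v)) = G.degree w - 1 := fun w hw => by
    rw [card_erase_of_mem (by simpa using ⟨huv, hw⟩), G.card_incidenceFinset_eq_degree]
  have hsub : ∀ w, ∀ e ∈ G.edgeSet, w ∈ e → e ∉ ({s(u, v)} : Set (Sym2 V)) →
      e ∈ (G.incidenceFinset w).erase s(u, v) := fun w e he hw h =>
    mem_erase.2 ⟨h, by simpa using ⟨he, hw⟩⟩
  have hF := card_forbiddenColors_le cV cE (Set.mem_singleton u) (hsub u) (hsub v)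
  rw [hcard u (Sym2.mem_mk_left u v), hcard v (Sym2.mem_mk_right u v)] at hF
  obtain ⟨a, -, ha⟩ := exists_mem_notMem_of_card_lt_card
    (s := forbiddenColors G {s(u, v)} {u} cV cE s(u, v)) (t := univ)
    (by rw [card_univ, Fintype.card_fin]; omega)
  refine hno (HasTotalColoring.of_recoloring (U := {u}) (S := {s(u, v)}) (f := fun _ => a)
    ?_ ?_ (Set.mem_singleton _) ⟨u, v, rfl, rfl⟩ hV hE hVE ?_ ?_)
  · rintro _ rfl _ rfl
    exact G.irrefl
  · rintro _ rfl
    omega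
  · rintro _ rfl
    exact ha
  · rintro _ rfl _ rfl h
    exact absurd rfl h

/-- Even cycles are 2-choosable. -/
theorem exists_periodic_choice {α : Type*} {n : ℕ} (hn : Even n) (h0 : 0 < n)
    {L : ℕ → Finset α} (hL : Function.Periodic L n) (hcard : ∀ k, 2 ≤ (L k).card) :
    ∃ c : ℕ → α, Function.Periodic c n ∧ ∀ k, c k ∈ L k ∧ c k ≠ c (k + 1) := by
  classical
  obtain ⟨t, ht⟩ : ∃ t : Finset α → Finset α, ∀ s, 2 ≤ s.card → t s ⊆ s ∧ (t s).card = 2 := by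
    have : ∀ s : Finset α, ∃ t : Finset α, 2 ≤ s.card → t ⊆ s ∧ t.card = 2 := fun s => by
      by_cases hs : 2 ≤ s.card
      · exact (Finset.exists_subset_card_eq hs).imp fun t ht _ => ht
      · exact ⟨∅, fun h => absurd h hs⟩
    choose t ht using this
    exact ⟨t, ht⟩
  by_cases hconst : ∀ k, t (L (k + 1)) ⊆ t (L k)
  · obtain ⟨a, b, hab, hL0⟩ := Finset.card_eq_two.1 (ht _ (hcard 0)).2
    have hall : ∀ k, t (L k) = {a, b} := by
      intro k
      induction k with
      | zero => exact hL0
      | succ k ih =>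
        rw [← ih]
        exact Finset.eq_of_subset_of_card_le (hconst k)
          (by rw [(ht _ (hcard k)).2, (ht _ (hcard (k + 1))).2])
    refine ⟨fun k => if Even k then a else b, fun k => ?_, fun k => ⟨(ht _ (hcard k)).1 ?_, ?_⟩⟩
    · simp [Nat.even_add, hn]
    · rw [hall]
      by_cases hk : Even k <;> simp [hk]
    · by_cases hk : Even k <;> simp [Nat.even_add_one, hk, hab, hab.symm]
  · push Not at hconst
    obtain ⟨m, hm⟩ := hconst
    obtain ⟨x, hx, hxm⟩ := Finset.not_subset.1 hm
    have step : ∀ (k : ℕ) (y : α), ∃ z, z ∈ t (L k) ∧ z ≠ y := fun k y => by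
      obtain ⟨z, hz, hzy⟩ := Finset.exists_mem_ne
        (by rw [(ht _ (hcard k)).2]; norm_num : 1 < (t (L k)).card) y
      exact ⟨z, hz, hzy⟩
    choose g hg hg' using step
    let d : ℕ → α := fun k => Nat.rec x (fun j y => g (m + 1 + (j + 1)) y) k
    have hd : ∀ k, d k ∈ t (L (m + 1 + k)) := by
      rintro (_ | k)
      · exact hx
      · exact hg _ _
    have hd' : ∀ k, d k ≠ d (k + 1) := fun k => (hg' _ _).symm
    -- `c` reads off `d` along the residue of `k - (m + 1)` modulo `n`.
    have hper : ∀ q k, L (k + n * q) = L k := fun q k => by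
      have := hL.nat_mul q k
      rwa [mul_comm, Nat.cast_id] at this
    obtain ⟨s, hs⟩ : ∃ s, s + (m + 1) = n * (m + 1) :=
      ⟨n * (m + 1) - (m + 1), Nat.sub_add_cancel (Nat.le_mul_of_pos_left _ h0)⟩
    have hmem : ∀ k, d ((k + s) % n) ∈ t (L k) := fun k => by
      have h₁ : (m + 1 + (k + s) % n) + n * ((k + s) / n) = k + n * (m + 1) := by
        have := Nat.mod_add_div (k + s) n
        omega
      have h₂ := hd ((k + s) % n)
      rwa [← hper ((k + s) / n), h₁, hper] at h₂
    refine ⟨fun k => d ((k + s) % n), fun k => ?_, fun k => ⟨(ht _ (hcard k)).1 (hmem k), ?_⟩⟩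
    · simp [add_right_comm k n s]
    · show d ((k + s) % n) ≠ d ((k + 1 + s) % n)
      rw [add_right_comm k 1 s]
      by_cases hlt : (k + s) % n + 1 < n
      · rw [← Nat.mod_add_mod (k + s), Nat.mod_eq_of_lt hlt]
        exact hd' _
      · have h₁ : (k + s) % n + 1 = n := by
          have := Nat.mod_lt (k + s) h0
          omega
        rw [← Nat.mod_add_mod (k + s), h₁, Nat.mod_self]
        intro h
        have h₂ := hd ((k + s) % n)
        rw [h, show m + 1 + (k + s) % n = m + n by omega, hL] at h₂
        exact hxm h₂

/-- In an r-minimal graph (r ≥ 13), the spanning subgraph whose edges are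
the edges of G with at least one endpoint of degree 3 is a forest (acyclic). -/
theorem stmt_7 {V : Type*} [Fintype V] (r : ℕ) (hr : 13 ≤ r)
    (G : SimpleGraph V) [DecidableRel G.Adj] (hG : IsRMinimal r G) :
    (SimpleGraph.fromRel
      (fun a b => G.Adj a b ∧ (G.degree a = 3 ∨ G.degree b = 3))).IsAcyclic := by
  classical
  intro v₀ p hp
  have h3 : ∀ {u v}, G.Adj u v → G.degree u = 3 → G.degree v = r :=
    fun huv hu => hG.degree_eq_of_adj (by omega) huv hu
  set n := p.length with hn
  have hn3 : 3 ≤ n := hp.three_le_length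
  have hn0 : 0 < n := by omega
  let w : ℕ → V := fun k => p.getVert (k % n)
  have hwper : ∀ k, w (k + n) = w k := fun k => by simp [w]
  have hw_inj : ∀ {i j}, w i = w j → i ≡ j [MOD n] := fun {i j} h => by
    have hi := Nat.mod_lt i hn0
    have hj := Nat.mod_lt j hn0
    exact hp.getVert_injOn' (by rw [Set.mem_ofPred_eq]; omega)
      (by rw [Set.mem_ofPred_eq]; omega) h
  have hw_congr : ∀ {i j}, i ≡ j [MOD n] → w i = w j := fun h => congrArg p.getVert h
  have hw_adj : ∀ k, G.Adj (w k) (w (k + 1)) ∧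
      (G.degree (w k) = 3 ∨ G.degree (w (k + 1)) = 3) := by
    intro k
    have hk := Nat.mod_lt k hn0
    have hsucc : w (k + 1) = p.getVert (k % n + 1) := by
      by_cases hlt : k % n + 1 < n
      · simp only [w]
        rw [← Nat.mod_add_mod, Nat.mod_eq_of_lt hlt]
      · have : k % n + 1 = n := by omega
        simp only [w]
        rw [← Nat.mod_add_mod, this, Nat.mod_self, hn, p.getVert_length, p.getVert_zero]
    have h := p.adj_getVert_succ hk
    rw [← hsucc, SimpleGraph.fromRel_adj] at h
    rcases h.2 with h | h
    · exact h
    · exact ⟨h.1.symm, h.2.symm⟩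
  have hw3 : ∀ k, G.degree (w (k + 1)) = 3 ↔ ¬ G.degree (w k) = 3 := fun k => by
    obtain ⟨hadj, h | h⟩ := hw_adj k
    · have := h3 hadj h
      omega
    · have := h3 hadj.symm h
      omega
  have hpar : ∀ k, G.degree (w k) = 3 ↔ (Even k ↔ G.degree (w 0) = 3) := by
    intro k
    induction k with
    | zero => simp
    | succ k ih => rw [hw3, ih, Nat.even_add_one]; tauto
  have hn_even : Even n := by
    have h₁ := hpar n
    have h₂ := hwper 0
    rw [zero_add] at h₂
    rw [h₂] at h₁
    tauto
  let e : ℕ → Sym2 V := fun k => s(w k, w (k + 1))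
  have he_per : Function.Periodic e n := fun k => by
    simp only [e, add_right_comm k n 1, hwper]
  have he_G : ∀ k, e k ∈ G.edgeSet := fun k => (hw_adj k).1
  have he_inj : ∀ {i j}, e i = e j → i ≡ j [MOD n] := fun {i j} h => by
    rcases Sym2.eq_iff.1 h with ⟨h, -⟩ | ⟨h₁, h₂⟩
    · exact hw_inj h
    · have h₁ := hw_inj h₁
      have h₂ := hw_inj h₂
      have h₄ : i + 2 ≡ i + 0 [MOD n] := (h₂.add_right 1).trans h₁.symm
      have h₅ := (Nat.modEq_zero_iff_dvd.1 (Nat.ModEq.add_left_cancel' i h₄))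
      have := Nat.le_of_dvd (by norm_num) h₅
      omega
  obtain ⟨-, hmax, hno, hmin⟩ := hG
  obtain ⟨cV, cE, hV, hE, hVE⟩ := hmin (e 0) (he_G 0)
  let U : Set V := {u | G.degree u = 3}
  let S : Set (Sym2 V) := Set.range e
  -- Every vertex of the cycle lies on two of its edges.
  have hB : ∀ k, ∃ B : Finset (Sym2 V), B.card + 2 = G.degree (w (k + 1)) ∧
      ∀ e' ∈ G.edgeSet, w (k + 1) ∈ e' → e' ∉ S → e' ∈ B := by
    intro k
    have hne : e k ≠ e (k + 1) := fun h => by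
      have h₁ : k + 0 ≡ k + 1 [MOD n] := he_inj h
      have h₂ := (Nat.modEq_zero_iff_dvd.1 (Nat.ModEq.add_left_cancel' k h₁).symm)
      have := Nat.le_of_dvd (by norm_num) h₂
      omega
    have hsub : ({e k, e (k + 1)} : Finset (Sym2 V)) ⊆ G.incidenceFinset (w (k + 1)) := by
      intro x hx
      rcases Finset.mem_insert.1 hx with rfl | hx
      · exact (G.mem_incidenceFinset _ _).2 ⟨he_G k, Sym2.mem_mk_right _ _⟩
      · rw [Finset.mem_singleton.1 hx]
        exact (G.mem_incidenceFinset _ _).2 ⟨he_G (k + 1), Sym2.mem_mk_left _ _⟩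
    refine ⟨G.incidenceFinset (w (k + 1)) \ {e k, e (k + 1)}, ?_, fun e' he' hwe heS => ?_⟩
    · rw [← G.card_incidenceFinset_eq_degree, ← Finset.card_pair hne]
      exact Finset.card_sdiff_add_card_eq_card hsub
    · refine Finset.mem_sdiff.2 ⟨(G.mem_incidenceFinset _ _).2 ⟨he', hwe⟩, fun h => heS ?_⟩
      rcases Finset.mem_insert.1 h with rfl | h
      · exact ⟨k, rfl⟩
      · exact ⟨k + 1, (Finset.mem_singleton.1 h).symm⟩
  have hF : ∀ k, (forbiddenColors G S U cV cE (e k)).card ≤ r := by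
    intro k
    obtain ⟨B₁, hB₁, hB₁'⟩ := hB (k + n - 1)
    obtain ⟨B₂, hB₂, hB₂'⟩ := hB k
    rw [Nat.sub_add_cancel (by omega), hwper] at hB₁ hB₁'
    have hd₁ := (G.degree_le_maxDegree (w k)).trans hmax
    have hd₂ := (G.degree_le_maxDegree (w (k + 1))).trans hmax
    rcases (hw_adj k).2 with h | h
    · have := card_forbiddenColors_le cV cE (S := S) (U := U) h hB₁' hB₂'
      simp only [e]
      omega
    · have := card_forbiddenColors_le cV cE (S := S) (U := U) h hB₂' hB₁'
      rw [Sym2.eq_swap] at this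
      simp only [e]
      omega
  obtain ⟨c, hc_per, hc⟩ := exists_periodic_choice hn_even hn0
    (L := fun k => (forbiddenColors G S U cV cE (e k))ᶜ)
    (fun k => by simp only [he_per k]) (fun k => by
      have := hF k
      rw [Finset.card_compl, Fintype.card_fin]
      omega)
  have hc_congr : ∀ {i j}, i ≡ j [MOD n] → c i = c j := fun {i j} h => by
    rw [← hc_per.map_mod_nat i, ← hc_per.map_mod_nat j, h]
  have hfac : Function.FactorsThrough c e := fun i j h => hc_congr (he_inj h)
  have he_congr : ∀ {i j}, i ≡ j [MOD n] → e i = e j := fun {i j} h => by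
    rw [← he_per.map_mod_nat i, ← he_per.map_mod_nat j, h]
  refine hno (HasTotalColoring.of_recoloring (U := U) (S := S) (f := Function.extend e c cE)
    ?_ ?_ ⟨0, rfl⟩ ?_ hV hE hVE ?_ ?_)
  · intro u (hu : _ = 3) v (hv : _ = 3) huv
    have := h3 huv hu
    omega
  · intro u (hu : _ = 3)
    omega
  · rcases (hw_adj 0).2 with h | h
    · exact ⟨_, _, rfl, h⟩
    · exact ⟨_, _, Sym2.eq_swap, h⟩
  · rintro _ ⟨k, rfl⟩
    rw [hfac.extend_apply]
    exact Finset.mem_compl.1 (hc k).1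
  · rintro _ ⟨i, rfl⟩ _ ⟨j, rfl⟩ hne ⟨x, hxi, hxj⟩
    rw [hfac.extend_apply, hfac.extend_apply]
    rcases Sym2.mem_iff.1 hxi with hxi | hxi <;> rcases Sym2.mem_iff.1 hxj with hxj | hxj
    · exact absurd (he_congr (hw_inj (hxi.symm.trans hxj))) hne
    · rw [hc_congr (hw_inj (hxi.symm.trans hxj))]
      exact (hc j).2.symm
    · rw [← hc_congr (hw_inj (hxi.symm.trans hxj))]
      exact (hc i).2
    · exact absurd (he_congr (Nat.ModEq.add_right_cancel' 1 (hw_inj (hxi.symm.trans hxj)))) hne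
end
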